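/- Fix an integer n ≥ 1, a function φ_n : {−1,+1}^n → ℝ, and β ∈ [0,∞). With H_N(σ) = N·C(N,n)⁻¹ Σ_{1≤i₁<⋯<i_n≤N} φ_n(σ_{i₁},…,σ_{i_n}), Z_N(β) = 2^{−N} Σ_{σ∈{−1,+1}^N} exp(−β H_N(σ)), and Ω_N(β) = log Z_N(β), the pressure p(β) = lim_{N→∞, N≥n} N⁻¹ Ω_N(β) exists as a finite real number; moreover for every N ≥ n one has Ω_N(β) ≥ −β N · 2^{−n} Σ_{τ∈{−1,+1}^n} φ_n(τ), so that p(β) ≥ −β · 2^{−n} Σ_{τ∈{−1,+1}^n} φ_n(τ). -/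

import Mathlib

open Filter

open scoped Classical in
/-- The finset of strictly increasing maps `Fin n → Fin m`. -/
noncomputable def strictMonoMaps (n m : ℕ) : Finset (Fin n → Fin m) :=
  Finset.univ.filter StrictMono

/-- The oriented mean-field Hamiltonian on `m` Ising spins built from the `n`-body
interaction `φ`: `H_m(σ) = m·C(m,n)⁻¹ Σ_{i₁<⋯<i_n} φ(σ_{i₁},…,σ_{i_n})`. -/
noncomputable def mfHamiltonian (n m : ℕ) (φ : (Fin n → ℤˣ) → ℝ)
    (σ : Fin m → ℤˣ) : ℝ :=
  (m : ℝ) * ((m.choose n : ℝ))⁻¹ * ∑ ι ∈ strictMonoMaps n m, φ (σ ∘ ι)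

/-- The normalized partition function `Z_m(β) = 2^{−m} Σ_σ exp(−β H_m(σ))`. -/
noncomputable def mfPartition (n : ℕ) (φ : (Fin n → ℤˣ) → ℝ) (β : ℝ) (m : ℕ) : ℝ :=
  ((2 : ℝ) ^ m)⁻¹ * ∑ σ : Fin m → ℤˣ, Real.exp (-β * mfHamiltonian n m φ σ)

/-- The thermodynamic potential `Ω_m(β) = log Z_m(β)`. -/
noncomputable def mfPotential (n : ℕ) (φ : (Fin n → ℤˣ) → ℝ) (β : ℝ) (m : ℕ) : ℝ :=
  Real.log (mfPartition n φ β m)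

section Combinatorics

variable {n k l N : ℕ}

/-- The value of `φ` on the coordinates of `σ` in `T`, listed in increasing order, when
`T` has `n` elements, and `0` otherwise. -/
noncomputable def finsetInteraction (φ : (Fin n → ℤˣ) → ℝ) (σ : Fin N → ℤˣ)
    (T : Finset (Fin N)) : ℝ :=
  if h : T.card = n then φ (σ ∘ T.orderEmbOfFin h) else 0

lemma finsetInteraction_image (φ : (Fin n → ℤˣ) → ℝ) (σ : Fin N → ℤˣ) {f : Fin n → Fin N}
    (hf : StrictMono f) : finsetInteraction φ σ (Finset.univ.image f) = φ (σ ∘ f) := by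
  have hc : (Finset.univ.image f).card = n := by
    simp [Finset.card_image_of_injective _ hf.injective]
  rw [finsetInteraction, dif_pos hc,
    ← Finset.orderEmbOfFin_unique hc (fun x => Finset.mem_image_of_mem f (Finset.mem_univ x)) hf]

lemma sum_strictMonoMaps_orderEmbOfFin (φ : (Fin n → ℤˣ) → ℝ) (σ : Fin N → ℤˣ)
    (S : Finset (Fin N)) (hS : S.card = k) :
    ∑ ι ∈ strictMonoMaps n k, φ ((σ ∘ S.orderEmbOfFin hS) ∘ ι) =
      ∑ T ∈ S.powersetCard n, finsetInteraction φ σ T := by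
  have mono {ι : Fin n → Fin k} (hι : ι ∈ strictMonoMaps n k) :
      StrictMono (S.orderEmbOfFin hS ∘ ι) :=
    (S.orderEmbOfFin hS).strictMono.comp (by simpa [strictMonoMaps] using hι)
  refine Finset.sum_bij (fun ι _ => Finset.univ.image (S.orderEmbOfFin hS ∘ ι)) ?_ ?_ ?_ ?_
  · intro ι hι
    rw [Finset.mem_powersetCard]
    refine ⟨?_, by simp [Finset.card_image_of_injective _ (mono hι).injective]⟩
    intro x hx
    obtain ⟨i, -, rfl⟩ := Finset.mem_image.1 hx
    exact Finset.orderEmbOfFin_mem _ _ _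
  · intro ι₁ h₁ ι₂ h₂ h
    have hr : Set.range (S.orderEmbOfFin hS ∘ ι₁) = Set.range (S.orderEmbOfFin hS ∘ ι₂) := by
      simpa only [Finset.coe_image, Finset.coe_univ, Set.image_univ] using
        congrArg (fun T : Finset (Fin N) => (T : Set (Fin N))) h
    exact (S.orderEmbOfFin hS).injective.comp_left (((mono h₁).range_inj (mono h₂)).1 hr)
  · intro T hT
    obtain ⟨hTS, hT⟩ := Finset.mem_powersetCard.1 hT
    let ι : Fin n → Fin k := fun i =>
      (S.orderIsoOfFin hS).symm ⟨T.orderEmbOfFin hT i, hTS (T.orderEmbOfFin_mem hT i)⟩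
    have hι : S.orderEmbOfFin hS ∘ ι = T.orderEmbOfFin hT := by
      funext i
      simp [ι, ← Finset.coe_orderIsoOfFin_apply]
    refine ⟨ι, ?_, ?_⟩
    · simp only [strictMonoMaps, Finset.mem_filter, Finset.mem_univ, true_and]
      intro i j hij
      exact (S.orderIsoOfFin hS).symm.strictMono ((T.orderEmbOfFin hT).strictMono hij)
    · rw [hι, Finset.image_orderEmbOfFin_univ]
  · intro ι hι
    rw [finsetInteraction_image φ σ (mono hι)]
    rfl

lemma sum_strictMonoMaps (φ : (Fin n → ℤˣ) → ℝ) (σ : Fin N → ℤˣ) :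
    ∑ ι ∈ strictMonoMaps n N, φ (σ ∘ ι) =
      ∑ T ∈ Finset.univ.powersetCard n, finsetInteraction φ σ T := by
  rw [← sum_strictMonoMaps_orderEmbOfFin φ σ Finset.univ (Finset.card_fin N),
    ← Finset.orderEmbOfFin_unique (Finset.card_fin N) (fun x => Finset.mem_univ x) strictMono_id]
  rfl

lemma card_strictMonoMaps (n N : ℕ) : (strictMonoMaps n N).card = N.choose n := by
  have h := sum_strictMonoMaps (n := n) (fun _ => 1) (fun _ : Fin N => 1)
  rw [Finset.sum_congr rfl (g := fun _ => (1 : ℝ)) (s₂ := Finset.univ.powersetCard n)] at h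
  · simpa using h
  · intro T hT
    simp [finsetInteraction, (Finset.mem_powersetCard.1 hT).2]

lemma card_subtype_card_eq (N k : ℕ) :
    Fintype.card {S : Finset (Fin N) // S.card = k} = N.choose k := by
  simp

lemma sum_sum_powersetCard (hnk : n ≤ k) (F : Finset (Fin N) → ℝ) :
    ∑ S : {S : Finset (Fin N) // S.card = k}, ∑ T ∈ S.val.powersetCard n, F T =
      (N - n).choose (k - n) * ∑ T ∈ Finset.univ.powersetCard n, F T := by
  rw [← Finset.sum_subtype (p := fun S => S.card = k) (Finset.univ.powersetCard k) (by simp)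
      (fun S => ∑ T ∈ S.powersetCard n, F T),
    Finset.sum_comm' (t' := Finset.univ.powersetCard n)
      (s' := fun T => {S ∈ Finset.univ.powersetCard k | T ⊆ S})
      (by intro S T; simp only [Finset.mem_powersetCard, Finset.mem_filter]; grind),
    Finset.mul_sum]
  refine Finset.sum_congr rfl fun T hT => ?_
  have hT := (Finset.mem_powersetCard.1 hT).2
  rw [Finset.sum_const, nsmul_eq_mul]
  congr 2
  rw [Finset.card_filter_powersetCard_subset T _ k (Finset.subset_univ T) (hT.trans_le hnk), hT,
    Finset.card_fin]

/-- The spins in `S` and those outside `S` are independent. -/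
lemma sum_mul_sum_orderEmbOfFin (S : Finset (Fin N)) (hk : S.card = k) (hl : Sᶜ.card = l)
    (f : (Fin k → ℤˣ) → ℝ) (g : (Fin l → ℤˣ) → ℝ) :
    ∑ σ : Fin N → ℤˣ, f (σ ∘ S.orderEmbOfFin hk) * g (σ ∘ Sᶜ.orderEmbOfFin hl) =
      (∑ σ, f σ) * ∑ σ, g σ := by
  rw [Finset.sum_mul_sum, ← Fintype.sum_prod_type']
  refine Fintype.sum_equiv (((finSumEquivOfFinset hk hl).arrowCongr (Equiv.refl ℤˣ)).symm.trans
    (Equiv.sumArrowEquivProdArrow _ _ _)) _ _ fun σ => ?_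
  congr 2

end Combinatorics

section Density

variable {n : ℕ}

/-- The energy per spin, extended to systems of fewer than `n` spins by a lower bound
for the interaction. -/
noncomputable def mfDensity (n m : ℕ) (φ : (Fin n → ℤˣ) → ℝ) (σ : Fin m → ℤˣ) : ℝ :=
  if n ≤ m then ((m.choose n : ℝ))⁻¹ * ∑ ι ∈ strictMonoMaps n m, φ (σ ∘ ι)
  else -∑ τ, |φ τ|

lemma abs_mfDensity_le (m : ℕ) (φ : (Fin n → ℤˣ) → ℝ) (σ : Fin m → ℤˣ) :
    |mfDensity n m φ σ| ≤ ∑ τ, |φ τ| := by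
  rw [mfDensity]
  split_ifs with h
  · have hc : (0 : ℝ) < m.choose n := by exact_mod_cast Nat.choose_pos h
    rw [abs_mul, abs_of_pos (inv_pos.2 hc), inv_mul_le_iff₀ hc]
    refine (Finset.abs_sum_le_sum_abs _ _).trans ?_
    rw [← card_strictMonoMaps, ← nsmul_eq_mul]
    refine Finset.sum_le_card_nsmul _ _ _ fun ι _ => ?_
    exact Finset.single_le_sum (f := fun τ => |φ τ|) (fun _ _ => abs_nonneg _)
      (Finset.mem_univ (σ ∘ ι))
  · rw [abs_neg, abs_of_nonneg (Finset.sum_nonneg fun _ _ => abs_nonneg _)]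

/-- Averaging the energy density over all subsystems of `k` spins does not increase it. -/
lemma sum_mfDensity_le {k N : ℕ} (hkN : k ≤ N) (φ : (Fin n → ℤˣ) → ℝ) (σ : Fin N → ℤˣ) :
    ∑ S : {S : Finset (Fin N) // S.card = k}, mfDensity n k φ (σ ∘ S.val.orderEmbOfFin S.property) ≤
      N.choose k * mfDensity n N φ σ := by
  by_cases hnk : n ≤ k
  · simp only [mfDensity, if_pos hnk, if_pos (hnk.trans hkN), sum_strictMonoMaps_orderEmbOfFin]
    rw [← Finset.mul_sum, sum_sum_powersetCard hnk, sum_strictMonoMaps]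
    have h₁ : (k.choose n : ℝ) ≠ 0 := by exact_mod_cast (Nat.choose_pos hnk).ne'
    have h₂ : (N.choose n : ℝ) ≠ 0 := by exact_mod_cast (Nat.choose_pos (hnk.trans hkN)).ne'
    have h : (N.choose k * k.choose n : ℝ) = N.choose n * (N - n).choose (k - n) := by
      exact_mod_cast Nat.choose_mul (n := N) hnk
    apply le_of_eq
    field_simp
    linear_combination (-∑ T ∈ Finset.univ.powersetCard n, finsetInteraction φ σ T) * h
  · rw [Finset.sum_congr rfl fun S _ => show mfDensity n k φ _ = -∑ τ, |φ τ| from if_neg hnk,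
      Finset.sum_const, Finset.card_univ, card_subtype_card_eq, nsmul_eq_mul]
    exact mul_le_mul_of_nonneg_left (neg_le_of_abs_le (abs_mfDensity_le N φ σ)) (Nat.cast_nonneg _)

lemma sum_mfDensity_compl_le {k l : ℕ} (φ : (Fin n → ℤˣ) → ℝ) (σ : Fin (k + l) → ℤˣ)
    (hc : ∀ S : {S : Finset (Fin (k + l)) // S.card = k}, S.valᶜ.card = l) :
    ∑ S : {S : Finset (Fin (k + l)) // S.card = k},
        mfDensity n l φ (σ ∘ S.valᶜ.orderEmbOfFin (hc S)) ≤
      (k + l).choose k * mfDensity n (k + l) φ σ := by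
  rw [Nat.choose_symm_add]
  refine le_of_eq_of_le ?_ (sum_mfDensity_le (Nat.le_add_left l k) φ σ)
  refine Fintype.sum_equiv
    ((compl_involutive (α := Finset (Fin (k + l)))).toPerm.subtypeEquiv fun S => ?_) _ _
    fun S => rfl
  have := Finset.card_add_card_compl S
  simp only [Fintype.card_fin] at this
  simp only [Function.Involutive.coe_toPerm]
  omega

/-- The potential of the extended energy density `mfDensity`. -/
noncomputable def mfExtPotential (n : ℕ) (φ : (Fin n → ℤˣ) → ℝ) (β : ℝ) (m : ℕ) : ℝ :=
  Real.log (((2 : ℝ) ^ m)⁻¹ * ∑ σ : Fin m → ℤˣ, Real.exp (-β * (m * mfDensity n m φ σ)))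

lemma mfExtPotential_eq (φ : (Fin n → ℤˣ) → ℝ) (β : ℝ) {m : ℕ} (h : n ≤ m) :
    mfExtPotential n φ β m = mfPotential n φ β m := by
  simp [mfExtPotential, mfPotential, mfPartition, mfHamiltonian, mfDensity, h, mul_assoc]

lemma sum_exp_pos (m : ℕ) (f : (Fin m → ℤˣ) → ℝ) : 0 < ∑ σ, Real.exp (f σ) :=
  Finset.sum_pos (fun _ _ => Real.exp_pos _) Finset.univ_nonempty

lemma card_spins (m : ℕ) : Fintype.card (Fin m → ℤˣ) = 2 ^ m := by simp

lemma le_log_sum_exp (m : ℕ) (f : (Fin m → ℤˣ) → ℝ) :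
    ((2 : ℝ) ^ m)⁻¹ * ∑ σ, f σ ≤ Real.log (((2 : ℝ) ^ m)⁻¹ * ∑ σ, Real.exp (f σ)) := by
  rw [Real.le_log_iff_exp_le (mul_pos (by positivity) (sum_exp_pos m f)), Finset.mul_sum,
    Finset.mul_sum]
  simpa only [smul_eq_mul] using convexOn_exp.map_sum_le (t := Finset.univ)
    (w := fun _ => ((2 : ℝ) ^ m)⁻¹) (p := f) (fun _ _ => by positivity)
    (by simp) (fun _ _ => Set.mem_univ _)

lemma mfExtPotential_subadditive (φ : (Fin n → ℤˣ) → ℝ) {β : ℝ} (hβ : 0 ≤ β) :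
    Subadditive (mfExtPotential n φ β) := by
  intro k l
  have hc (S : {S : Finset (Fin (k + l)) // S.card = k}) : S.valᶜ.card = l := by
    rw [Finset.card_compl, S.property, Fintype.card_fin, Nat.add_sub_cancel_left]
  have hC : (0 : ℝ) < (k + l).choose k := by exact_mod_cast Nat.choose_pos (Nat.le_add_right k l)
  let E (m : ℕ) (σ : Fin m → ℤˣ) : ℝ := Real.exp (-β * (m * mfDensity n m φ σ))
  have hE (σ : Fin (k + l) → ℤˣ) : E (k + l) σ ≤
      ((k + l).choose k : ℝ)⁻¹ * ∑ S : {S : Finset (Fin (k + l)) // S.card = k},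
        E k (σ ∘ S.val.orderEmbOfFin S.property) * E l (σ ∘ S.valᶜ.orderEmbOfFin (hc S)) := by
    have hJ := convexOn_exp.map_sum_le
      (t := (Finset.univ : Finset {S : Finset (Fin (k + l)) // S.card = k}))
      (w := fun _ => ((k + l).choose k : ℝ)⁻¹)
      (p := fun S => -β * (k * mfDensity n k φ (σ ∘ S.val.orderEmbOfFin S.property)) +
        -β * (l * mfDensity n l φ (σ ∘ S.valᶜ.orderEmbOfFin (hc S))))
      (fun _ _ => by positivity)
      (by rw [Finset.sum_const, Finset.card_univ, card_subtype_card_eq, nsmul_eq_mul,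
            mul_inv_cancel₀ hC.ne'])
      (fun _ _ => Set.mem_univ _)
    simp only [smul_eq_mul, Real.exp_add, ← Finset.mul_sum] at hJ
    refine le_trans (Real.exp_le_exp.2 ?_) hJ
    rw [Finset.sum_add_distrib, ← Finset.mul_sum, ← Finset.mul_sum, ← Finset.mul_sum,
      ← Finset.mul_sum, le_inv_mul_iff₀ hC]
    have h₁ := mul_le_mul_of_nonneg_left (sum_mfDensity_le (Nat.le_add_right k l) φ σ)
      (mul_nonneg hβ (Nat.cast_nonneg k))
    have h₂ := mul_le_mul_of_nonneg_left (sum_mfDensity_compl_le φ σ hc)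
      (mul_nonneg hβ (Nat.cast_nonneg l))
    push_cast
    linarith
  have hW : ∑ σ, E (k + l) σ ≤ (∑ σ, E k σ) * ∑ σ, E l σ := by
    refine (Finset.sum_le_sum fun σ _ => hE σ).trans_eq ?_
    rw [← Finset.mul_sum, Finset.sum_comm]
    simp only [sum_mul_sum_orderEmbOfFin]
    rw [Finset.sum_const, Finset.card_univ, card_subtype_card_eq, nsmul_eq_mul,
      inv_mul_cancel_left₀ hC.ne']
  have pos (m : ℕ) : 0 < ((2 : ℝ) ^ m)⁻¹ * ∑ σ, E m σ :=
    mul_pos (by positivity) (sum_exp_pos m _)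
  change Real.log (_ * ∑ σ, E (k + l) σ) ≤
    Real.log (_ * ∑ σ, E k σ) + Real.log (_ * ∑ σ, E l σ)
  rw [← Real.log_mul (pos k).ne' (pos l).ne']
  refine Real.log_le_log (pos _) ?_
  rw [mul_mul_mul_comm, pow_add, mul_inv]
  exact mul_le_mul_of_nonneg_left hW (by positivity)

lemma neg_mul_sum_abs_le_mfExtPotential_div (φ : (Fin n → ℤˣ) → ℝ) {β : ℝ} (hβ : 0 ≤ β) (m : ℕ) :
    -(β * ∑ τ, |φ τ|) ≤ mfExtPotential n φ β m / m := by
  have hM : 0 ≤ β * ∑ τ, |φ τ| := mul_nonneg hβ (Finset.sum_nonneg fun _ _ => abs_nonneg _)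
  rcases m.eq_zero_or_pos with rfl | hm
  · simpa using hM
  have hm : (0 : ℝ) < m := by exact_mod_cast hm
  rw [le_div_iff₀ hm]
  refine le_trans ?_ (le_log_sum_exp m _)
  rw [le_inv_mul_iff₀ (by positivity)]
  have h := Finset.card_nsmul_le_sum Finset.univ
    (fun σ : Fin m → ℤˣ => -β * (m * mfDensity n m φ σ)) (-(β * ∑ τ, |φ τ|) * m) fun σ _ => by
      have := mul_le_mul_of_nonneg_left (le_of_abs_le (abs_mfDensity_le m φ σ))
        (mul_nonneg hβ hm.le)
      linarith
  rwa [Finset.card_univ, card_spins, nsmul_eq_mul, Nat.cast_pow, Nat.cast_ofNat] at h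

lemma sum_finsetInteraction {N : ℕ} (φ : (Fin n → ℤˣ) → ℝ) {T : Finset (Fin N)}
    (hT : T.card = n) :
    ((2 : ℝ) ^ N)⁻¹ * ∑ σ : Fin N → ℤˣ, finsetInteraction φ σ T =
      ((2 : ℝ) ^ n)⁻¹ * ∑ τ, φ τ := by
  have hle : n ≤ N := by simpa [hT] using T.card_le_univ
  have h := sum_mul_sum_orderEmbOfFin T hT (by rw [Finset.card_compl, hT, Fintype.card_fin])
    φ (fun _ : Fin (N - n) → ℤˣ => 1)
  simp only [mul_one, Finset.sum_const, Finset.card_univ, card_spins, nsmul_eq_mul] at h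
  simp only [finsetInteraction, dif_pos hT, h]
  have h2 : (2 : ℝ) ^ N = 2 ^ (N - n) * 2 ^ n := by rw [← pow_add, Nat.sub_add_cancel hle]
  rw [h2]
  push_cast
  field_simp

lemma le_mfPotential (φ : (Fin n → ℤˣ) → ℝ) (β : ℝ) {N : ℕ} (h : n ≤ N) :
    -β * N * ((2 : ℝ) ^ n)⁻¹ * ∑ τ, φ τ ≤ mfPotential n φ β N := by
  refine le_of_eq_of_le ?_ (le_log_sum_exp N _)
  have hC : (N.choose n : ℝ) ≠ 0 := by exact_mod_cast (Nat.choose_pos h).ne'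
  have hs : ((2 : ℝ) ^ N)⁻¹ * ∑ σ : Fin N → ℤˣ, ∑ ι ∈ strictMonoMaps n N, φ (σ ∘ ι) =
      N.choose n * (((2 : ℝ) ^ n)⁻¹ * ∑ τ, φ τ) := by
    simp only [sum_strictMonoMaps]
    rw [Finset.sum_comm, Finset.mul_sum, Finset.sum_congr rfl fun T hT =>
      sum_finsetInteraction φ (Finset.mem_powersetCard.1 hT).2]
    simp
  simp only [mfHamiltonian]
  rw [← Finset.mul_sum, ← Finset.mul_sum, mul_left_comm, mul_left_comm _ (_ * _), hs]
  field_simp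

end Density

/-- **Existence and finiteness of the pressure** for oriented mean-field spin chains:
the limit `p(β) = lim_{N→∞} N⁻¹ Ω_N(β)` exists as a finite real number; moreover
`Ω_N(β) ≥ −β·N·2^{−n} Σ_τ φ(τ)` for every `N ≥ n`, whence
`p(β) ≥ −β·2^{−n} Σ_τ φ(τ)`. -/
theorem mfPressure_exists
    (n : ℕ) (hn : 1 ≤ n) (φ : (Fin n → ℤˣ) → ℝ) (β : ℝ) (hβ : 0 ≤ β) :
    ∃ p : ℝ,
      Tendsto (fun N : ℕ => mfPotential n φ β N / N) atTop (nhds p) ∧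
      (∀ N, n ≤ N →
        mfPotential n φ β N ≥
          -β * N * ((2 : ℝ) ^ n)⁻¹ * ∑ τ : Fin n → ℤˣ, φ τ) ∧
      p ≥ -β * ((2 : ℝ) ^ n)⁻¹ * ∑ τ : Fin n → ℤˣ, φ τ := by
  have hbdd : BddBelow (Set.range fun m : ℕ => mfExtPotential n φ β m / m) := by
    refine ⟨-(β * ∑ τ, |φ τ|), ?_⟩
    rintro _ ⟨m, rfl⟩
    exact neg_mul_sum_abs_le_mfExtPotential_div φ hβ m
  have hlim : Tendsto (fun N : ℕ => mfPotential n φ β N / N) atTop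
      (nhds (mfExtPotential_subadditive φ hβ).lim) := by
    refine ((mfExtPotential_subadditive φ hβ).tendsto_lim hbdd).congr' ?_
    filter_upwards [eventually_ge_atTop n] with N hN
    rw [mfExtPotential_eq φ β hN]
  refine ⟨_, hlim, fun N hN => le_mfPotential φ β hN, ge_of_tendsto hlim ?_⟩
  filter_upwards [eventually_ge_atTop n] with N hN
  have hN0 : (0 : ℝ) < N := by exact_mod_cast hn.trans hN
  rw [le_div_iff₀ hN0]
  linarith [le_mfPotential φ β hN]
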